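/- Let E be a finite-dimensional real inner product space, Ω ⊆ E an open set, and let P : Ω → (E →L E) be a C¹ map such that P(x) is self-adjoint for every x ∈ Ω. Let u, v : Ω → ℝ be C² functions with v > 0 on Ω. Then for every x ∈ Ω, the divergence at x of the vector field y ↦ v(y)² · P(y)(∇(u/v)(y)) equals v(x)·div(P∇u)(x) − u(x)·div(P∇v)(x), where div(P∇f)(x) denotes the divergence at x of the vector field y ↦ P(y)(∇f(y)). -/

import Mathlib

open scoped RealInnerProductSpace

/-- The divergence of a vector field `X` at a point `x`: the trace of its Fréchet
derivative at `x`. -/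
noncomputable def vdiv {E : Type*} [NormedAddCommGroup E] [NormedSpace ℝ E]
    (X : E → E) (x : E) : ℝ :=
  LinearMap.trace ℝ E ((fderiv ℝ X x) : E →ₗ[ℝ] E)

section Divergence

variable {E : Type*} [NormedAddCommGroup E]

/-- Leibniz rule for the divergence of a scalar multiple of a vector field. -/
theorem vdiv_smul [NormedSpace ℝ E] [FiniteDimensional ℝ E] {f : E → ℝ} {X : E → E} {x : E}
    (hf : DifferentiableAt ℝ f x) (hX : DifferentiableAt ℝ X x) :
    vdiv (fun y => f y • X y) x = f x * vdiv X x + fderiv ℝ f x (X x) := by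
  have h : ((fderiv ℝ f x).smulRight (X x) : E →ₗ[ℝ] E)
      = (fderiv ℝ f x : E →ₗ[ℝ] ℝ).smulRight (X x) := rfl
  simp only [vdiv, fderiv_fun_smul hf hX, ContinuousLinearMap.toLinearMap_add,
    ContinuousLinearMap.toLinearMap_smul, map_add, map_smul, smul_eq_mul, h,
    LinearMap.trace_smulRight, ContinuousLinearMap.coe_coe]

theorem vdiv_sub [NormedSpace ℝ E] {X Y : E → E} {x : E}
    (hX : DifferentiableAt ℝ X x) (hY : DifferentiableAt ℝ Y x) :
    vdiv (fun y => X y - Y y) x = vdiv X x - vdiv Y x := by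
  simp only [vdiv, fderiv_fun_sub hX hY, ContinuousLinearMap.toLinearMap_sub, map_sub]

theorem Filter.EventuallyEq.vdiv_eq [NormedSpace ℝ E] {X Y : E → E} {x : E}
    (h : X =ᶠ[nhds x] Y) : vdiv X x = vdiv Y x := by
  rw [vdiv, vdiv, h.fderiv_eq]

end Divergence

section Gradient

variable {E : Type*} [NormedAddCommGroup E] [InnerProductSpace ℝ E] [CompleteSpace E]

/-- Quotient rule for the gradient, cleared of denominators. -/
theorem sq_smul_gradient_div {u v : E → ℝ} {x : E} (hu : DifferentiableAt ℝ u x)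
    (hv : DifferentiableAt ℝ v x) (hx : v x ≠ 0) :
    v x ^ 2 • gradient (fun z => u z / v z) x = v x • gradient u x - u x • gradient v x := by
  have h : fderiv ℝ (fun z => u z / v z) x
      = (v x ^ 2)⁻¹ • (v x • fderiv ℝ u x - u x • fderiv ℝ v x) := by
    simp only [div_eq_mul_inv]
    have hinv : HasFDerivAt (fun z => (v z)⁻¹) (-(v x ^ 2)⁻¹ • fderiv ℝ v x) x :=
      (hasDerivAt_inv hx).comp_hasFDerivAt x hv.hasFDerivAt
    rw [(hu.hasFDerivAt.fun_mul hinv).fderiv]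
    ext y
    simp only [add_apply, smul_apply, sub_apply, smul_eq_mul]
    field_simp
    ring
  simp only [gradient, h, map_smul, map_sub]
  rw [smul_inv_smul₀ (pow_ne_zero 2 hx)]

theorem ContDiffAt.differentiableAt_gradient {u : E → ℝ} {x : E} (hu : ContDiffAt ℝ 2 u x) :
    DifferentiableAt ℝ (gradient u) x := by
  have h : DifferentiableAt ℝ (fderiv ℝ u) x :=
    (hu.fderiv_right (m := 1) (by norm_num)).differentiableAt one_ne_zero
  exact (InnerProductSpace.toDual ℝ E).symm.toContinuousLinearEquiv.differentiableAt.comp x h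

end Gradient

/-- If `P` is a `C¹` field of self-adjoint linear maps on an open set `Ω` of a
finite-dimensional real inner product space, and `u, v` are `C²` functions on `Ω` with `v > 0`,
then for every `x ∈ Ω`,
`div(v² P ∇(u/v))(x) = v x · div(P ∇u)(x) − u x · div(P ∇v)(x)`. -/
theorem div_sq_smul_grad_ratio
    {E : Type*} [NormedAddCommGroup E] [InnerProductSpace ℝ E] [FiniteDimensional ℝ E]
    (Ω : Set E) (hΩ : IsOpen Ω)
    (P : E → E →L[ℝ] E) (hP : ContDiffOn ℝ 1 P Ω)
    (hP_selfadj : ∀ x ∈ Ω, ∀ a b : E, ⟪P x a, b⟫ = ⟪a, P x b⟫)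
    (u v : E → ℝ) (hu : ContDiffOn ℝ 2 u Ω) (hv : ContDiffOn ℝ 2 v Ω)
    (hv_pos : ∀ x ∈ Ω, 0 < v x)
    (x : E) (hx : x ∈ Ω) :
    vdiv (fun y => (v y) ^ 2 • P y (gradient (fun z => u z / v z) y)) x
      = v x * vdiv (fun y => P y (gradient u y)) x
        - u x * vdiv (fun y => P y (gradient v y)) x := by
  have hΩx : Ω ∈ nhds x := hΩ.mem_nhds hx
  have hdu := (hu.contDiffAt hΩx).differentiableAt two_ne_zero
  have hdv := (hv.contDiffAt hΩx).differentiableAt two_ne_zero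
  have hdP := (hP.contDiffAt hΩx).differentiableAt one_ne_zero
  have hPu : DifferentiableAt ℝ (fun y => P y (gradient u y)) x :=
    hdP.clm_apply (hu.contDiffAt hΩx).differentiableAt_gradient
  have hPv : DifferentiableAt ℝ (fun y => P y (gradient v y)) x :=
    hdP.clm_apply (hv.contDiffAt hΩx).differentiableAt_gradient
  have hfield : (fun y => (v y) ^ 2 • P y (gradient (fun z => u z / v z) y)) =ᶠ[nhds x]
      fun y => v y • P y (gradient u y) - u y • P y (gradient v y) := by
    filter_upwards [hΩx] with y hy
    have hΩy : Ω ∈ nhds y := hΩ.mem_nhds hy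
    rw [← map_smul, sq_smul_gradient_div ((hu.contDiffAt hΩy).differentiableAt two_ne_zero)
      ((hv.contDiffAt hΩy).differentiableAt two_ne_zero) (hv_pos y hy).ne', map_sub, map_smul,
      map_smul]
  have hsymm : fderiv ℝ v x (P x (gradient u x)) = fderiv ℝ u x (P x (gradient v x)) := by
    rw [← inner_gradient_left, ← inner_gradient_left, ← hP_selfadj x hx, real_inner_comm]
  rw [hfield.vdiv_eq, vdiv_sub (hdv.fun_smul hPu) (hdu.fun_smul hPv), vdiv_smul hdv hPu,
    vdiv_smul hdu hPv, hsymm]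
  ring
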